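/- arXiv:1111.3176 — 8 statements merged into one kernel-verified Lean document; each statement's English description precedes it below -/
import Mathlib

section
/- Let G be a simple connected undirected graph on vertex set {1,…,N} with N ≥ 2 and adjacency matrix (a_{ij}), and let β, δ ∈ (0,1]. If x is a positive stationary solution of the reactive SIS process on G, then for every node i with degree k_i = ∑_j a_{ij}, one has x_i < (1 − (1 − β/(1+δ))^{k_i}) / ((1 − (1 − β/(1+δ))^{k_i}) + δ), and this quantity is itself strictly less than 1/(1+δ). -/
/-- Let `G` be a simple connected undirected graph on `{1,…,N}` with `N ≥ 2`,
and let `β, δ ∈ (0,1]`. If `x` is a positive stationary solution of the reactive SIS process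
on `G`, then for every node `i` with degree `kᵢ`,
`x i < (1 - (1 - β/(1+δ))^kᵢ) / ((1 - (1 - β/(1+δ))^kᵢ) + δ)`,
and this quantity is itself strictly less than `1/(1+δ)`. -/
theorem reactive_upper_bound_one
    {N : ℕ} (hN : 2 ≤ N)
    (G : SimpleGraph (Fin N)) [DecidableRel G.Adj] (hconn : G.Connected)
    (β δ : ℝ) (hβ0 : 0 < β) (hβ1 : β ≤ 1) (hδ0 : 0 < δ) (hδ1 : δ ≤ 1)
    (x : Fin N → ℝ)
    (hx0 : ∀ i, 0 < x i) (hx1 : ∀ i, x i < 1)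
    (hstat : ∀ i, δ * x i =
      (1 - x i) * (1 - ∏ j, (1 - β * (if G.Adj i j then (1:ℝ) else 0) * x j))) :
    ∀ i, x i <
        (1 - (1 - β / (1 + δ)) ^ (G.degree i)) /
          ((1 - (1 - β / (1 + δ)) ^ (G.degree i)) + δ) ∧
      (1 - (1 - β / (1 + δ)) ^ (G.degree i)) /
          ((1 - (1 - β / (1 + δ)) ^ (G.degree i)) + δ) < 1 / (1 + δ) := by
  have hP : ∀ i, ∏ j, (1 - β * (if G.Adj i j then (1:ℝ) else 0) * x j)
      = ∏ j ∈ G.neighborFinset i, (1 - β * x j) := by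
    intro i
    rw [SimpleGraph.neighborFinset_eq_filter, Finset.prod_filter]
    refine Finset.prod_congr rfl fun j _ => ?_
    split_ifs <;> ring
  have hf : ∀ j, 0 < 1 - β * x j := by
    intro j
    nlinarith [hx0 j, hx1 j]
  have hub : ∀ j, x j < 1 / (1 + δ) := by
    intro j
    have h := hstat j
    rw [hP] at h
    have hp : 0 < ∏ l ∈ G.neighborFinset j, (1 - β * x l) :=
      Finset.prod_pos fun l _ => hf l
    rw [lt_div_iff₀ (by linarith)]
    nlinarith [mul_pos (sub_pos.2 (hx1 j)) hp]
  intro i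
  have hb : β / (1 + δ) < 1 := by
    rw [div_lt_one (by linarith)]
    linarith
  have hb0 : 0 < β / (1 + δ) := by positivity
  have : Nontrivial (Fin N) := Fin.nontrivial_iff_two_le.2 hN
  have hdeg : 0 < G.degree i := hconn.preconnected.degree_pos_of_nontrivial i
  have hQ0 : 0 < (1 - β / (1 + δ)) ^ (G.degree i) := pow_pos (by linarith) _
  have hQ1 : (1 - β / (1 + δ)) ^ (G.degree i) < 1 :=
    pow_lt_one₀ (by linarith) (by linarith) hdeg.ne'
  have hPQ : (1 - β / (1 + δ)) ^ (G.degree i)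
      < ∏ j ∈ G.neighborFinset i, (1 - β * x j) := by
    rw [← G.card_neighborFinset_eq_degree i, ← Finset.prod_const]
    refine Finset.prod_lt_prod_of_nonempty (fun _ _ => by linarith) (fun j _ => ?_) ?_
    · have h := mul_lt_mul_of_pos_left (hub j) hβ0
      rw [mul_one_div] at h
      linarith
    · rw [← Finset.card_pos, G.card_neighborFinset_eq_degree i]
      exact hdeg
  have h := hstat i
  rw [hP] at h
  generalize (1 - β / (1 + δ)) ^ (G.degree i) = Q at *
  have hd : 0 < 1 - Q + δ := by linarith
  constructor
  · rw [lt_div_iff₀ hd]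
    nlinarith [mul_pos (sub_pos.2 (hx1 i)) (sub_pos.2 hPQ)]
  · rw [div_lt_div_iff₀ hd (by linarith)]
    nlinarith [mul_pos hQ0 hδ0]
end

section
/- Let G be a simple connected undirected graph on vertex set {1,…,N} with N ≥ 2 and adjacency matrix (a_{ij}), let β, δ ∈ (0,1], and let x be a positive stationary solution of the reactive SIS process on G. Define the sequence of vectors u^n by u_i^0 = 1/(1+δ) for all i, and u_i^n = (1 − ∏_{j=1}^N (1 − β a_{ij} u_j^{n−1})) / ((1 − ∏_{j=1}^N (1 − β a_{ij} u_j^{n−1})) + δ). Then for every node i and every n ≥ 1: u_i^n < u_i^{n−1}, and x_i < u_i^n. -/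
/-- Let `G` be a simple connected undirected graph on `{1,…,N}` with `N ≥ 2`,
`β, δ ∈ (0,1]`, and let `x` be a positive stationary solution of the reactive SIS process
on `G`.  Define `u 0 i = 1/(1+δ)` and
`u (n+1) i = (1 - ∏ j, (1 - β a i j * u n j)) / ((1 - ∏ j, (1 - β a i j * u n j)) + δ)`.
Then for every node `i` and every `n ≥ 1` (written with `n+1`):
`u (n+1) i < u n i` and `x i < u (n+1) i`. -/
theorem reactive_upper_bounds_chain
    {N : ℕ} (hN : 2 ≤ N)
    (G : SimpleGraph (Fin N)) [DecidableRel G.Adj] (hconn : G.Connected)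
    (β δ : ℝ) (hβ0 : 0 < β) (hβ1 : β ≤ 1) (hδ0 : 0 < δ) (hδ1 : δ ≤ 1)
    (x : Fin N → ℝ)
    (hx0 : ∀ i, 0 < x i) (hx1 : ∀ i, x i < 1)
    (hstat : ∀ i, δ * x i =
      (1 - x i) * (1 - ∏ j, (1 - β * (if G.Adj i j then (1:ℝ) else 0) * x j)))
    (u : ℕ → Fin N → ℝ)
    (hu0 : ∀ i, u 0 i = 1 / (1 + δ))
    (huS : ∀ n i, u (n + 1) i =
      (1 - ∏ j, (1 - β * (if G.Adj i j then (1:ℝ) else 0) * u n j)) /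
        ((1 - ∏ j, (1 - β * (if G.Adj i j then (1:ℝ) else 0) * u n j)) + δ)) :
    ∀ i (n : ℕ), u (n + 1) i < u n i ∧ x i < u (n + 1) i := by
  have : Nontrivial (Fin N) := Fin.nontrivial_iff_two_le.mpr hN
  have hnb : ∀ i, ∃ j, G.Adj i j := by
    intro i
    have := hconn.preconnected.degree_pos_of_nontrivial i
    exact (G.degree_pos_iff_exists_adj i).mp this
  have hfac : ∀ (y : Fin N → ℝ), (∀ j, 0 < y j) → (∀ j, y j < 1) → ∀ i j,
      0 < 1 - β * (if G.Adj i j then (1:ℝ) else 0) * y j := by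
    intro y h0 h1 i j
    have := h0 j
    have := h1 j
    split_ifs
    · nlinarith
    · simp
  have hpos : ∀ (y : Fin N → ℝ), (∀ j, 0 < y j) → (∀ j, y j < 1) → ∀ i,
      0 < ∏ j, (1 - β * (if G.Adj i j then (1:ℝ) else 0) * y j) := by
    intro y h0 h1 i
    exact Finset.prod_pos (fun j _ => hfac y h0 h1 i j)
  have hle : ∀ (y : Fin N → ℝ), (∀ j, 0 < y j) → (∀ j, y j < 1) → ∀ i,
      ∏ j, (1 - β * (if G.Adj i j then (1:ℝ) else 0) * y j) ≤ 1 := by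
    intro y h0 h1 i
    refine Finset.prod_le_one (fun j _ => (hfac y h0 h1 i j).le) (fun j _ => ?_)
    have := h0 j
    split_ifs
    · nlinarith
    · simp
  have hlt : ∀ (y z : Fin N → ℝ), (∀ j, 0 < y j) → (∀ j, y j < z j) → (∀ j, z j < 1) → ∀ i,
      ∏ j, (1 - β * (if G.Adj i j then (1:ℝ) else 0) * z j) <
      ∏ j, (1 - β * (if G.Adj i j then (1:ℝ) else 0) * y j) := by
    intro y z h0 hyz h1 i
    obtain ⟨k, hk⟩ := hnb i
    refine Finset.prod_lt_prod
      (fun j _ => hfac z (fun j => (h0 j).trans (hyz j)) h1 i j) (fun j _ => ?_)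
      ⟨k, Finset.mem_univ k, ?_⟩
    · have := hyz j
      split_ifs
      · nlinarith
      · simp
    · have := hyz k
      rw [if_pos hk]
      nlinarith
  have hf : ∀ s t : ℝ, 0 ≤ s → s < t → s / (s + δ) < t / (t + δ) := by
    intro s t hs hst
    rw [div_lt_div_iff₀ (by linarith) (by linarith)]
    nlinarith
  have hxs : ∀ i, x i = (1 - ∏ j, (1 - β * (if G.Adj i j then (1:ℝ) else 0) * x j)) /
        ((1 - ∏ j, (1 - β * (if G.Adj i j then (1:ℝ) else 0) * x j)) + δ) := by
    intro i
    have h1 := hle x hx0 hx1 i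
    have h2 := hstat i
    rw [eq_div_iff (by linarith)]
    linarith
  have hu01 : ∀ i, u 0 i < 1 := by
    intro i
    rw [hu0, div_lt_one (by linarith)]
    linarith
  have hxu : ∀ i, x i < u 0 i := by
    intro i
    rw [hxs i, hu0]
    exact hf _ _ (by linarith [hle x hx0 hx1 i]) (by linarith [hpos x hx0 hx1 i])
  have hmono : ∀ (y z : Fin N → ℝ), (∀ j, 0 < y j) → (∀ j, y j < z j) → (∀ j, z j < 1) → ∀ i,
      (1 - ∏ j, (1 - β * (if G.Adj i j then (1:ℝ) else 0) * y j)) /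
        ((1 - ∏ j, (1 - β * (if G.Adj i j then (1:ℝ) else 0) * y j)) + δ) <
      (1 - ∏ j, (1 - β * (if G.Adj i j then (1:ℝ) else 0) * z j)) /
        ((1 - ∏ j, (1 - β * (if G.Adj i j then (1:ℝ) else 0) * z j)) + δ) := by
    intro y z h0 hyz h1 i
    exact hf _ _ (by linarith [hle y h0 (fun j => (hyz j).trans (h1 j)) i])
      (by linarith [hlt y z h0 hyz h1 i])
  have hxstep : ∀ n, (∀ i, x i < u n i) → (∀ i, u n i < 1) → ∀ i, x i < u (n + 1) i := by
    intro n h h1 i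
    rw [hxs i, huS]
    exact hmono x (u n) hx0 h h1 i
  have main : ∀ n, (∀ i, x i < u n i) ∧ (∀ i, u n i < 1) ∧ (∀ i, u (n + 1) i < u n i) := by
    intro n
    induction n with
    | zero =>
      refine ⟨hxu, hu01, fun i => ?_⟩
      have h0 : ∀ j, 0 < u 0 j := fun j => (hx0 j).trans (hxu j)
      rw [huS, hu0]
      exact hf _ _ (by linarith [hle (u 0) h0 hu01 i]) (by linarith [hpos (u 0) h0 hu01 i])
    | succ n ih =>
      obtain ⟨a, b, c⟩ := ih
      have a' := hxstep n a b
      refine ⟨a', fun i => (c i).trans (b i), fun i => ?_⟩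
      rw [huS (n + 1), huS n i]
      exact hmono (u (n + 1)) (u n) (fun j => (hx0 j).trans (a' j)) c b i
  intro i n
  obtain ⟨a, b, c⟩ := main n
  exact ⟨c i, hxstep n a b i⟩
end

section
/- Let G be a simple connected undirected graph on vertex set {1,…,N} with N ≥ 2 and adjacency matrix (a_{ij}), let β, δ ∈ (0,1], and suppose x is the unique positive stationary solution of the reactive SIS process on G. Define u_i^0 = 1/(1+δ) for all i and u_i^n = (1 − ∏_{j=1}^N (1 − β a_{ij} u_j^{n−1})) / ((1 − ∏_{j=1}^N (1 − β a_{ij} u_j^{n−1})) + δ). Then for every node i, the sequence u_i^n converges to x_i as n → ∞. -/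
/-- Let `G` be a simple connected undirected graph on `{1,…,N}` with `N ≥ 2`,
`β, δ ∈ (0,1]`, and suppose `x` is the unique positive stationary solution of the reactive
SIS process on `G`.  Define `u 0 i = 1/(1+δ)` and
`u (n+1) i = (1 - ∏ j, (1 - β a i j * u n j)) / ((1 - ∏ j, (1 - β a i j * u n j)) + δ)`.
Then for every node `i`, the sequence `u n i` converges to `x i` as `n → ∞`. -/
theorem reactive_upper_bounds_tendsto
    {N : ℕ} (hN : 2 ≤ N)
    (G : SimpleGraph (Fin N)) [DecidableRel G.Adj] (hconn : G.Connected)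
    (β δ : ℝ) (hβ0 : 0 < β) (hβ1 : β ≤ 1) (hδ0 : 0 < δ) (hδ1 : δ ≤ 1)
    (x : Fin N → ℝ)
    (hx0 : ∀ i, 0 < x i) (hx1 : ∀ i, x i < 1)
    (hstat : ∀ i, δ * x i =
      (1 - x i) * (1 - ∏ j, (1 - β * (if G.Adj i j then (1:ℝ) else 0) * x j)))
    (huniq : ∀ y : Fin N → ℝ, (∀ i, 0 < y i) → (∀ i, y i < 1) →
      (∀ i, δ * y i =
        (1 - y i) * (1 - ∏ j, (1 - β * (if G.Adj i j then (1:ℝ) else 0) * y j))) →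
      y = x)
    (u : ℕ → Fin N → ℝ)
    (hu0 : ∀ i, u 0 i = 1 / (1 + δ))
    (huS : ∀ n i, u (n + 1) i =
      (1 - ∏ j, (1 - β * (if G.Adj i j then (1:ℝ) else 0) * u n j)) /
        ((1 - ∏ j, (1 - β * (if G.Adj i j then (1:ℝ) else 0) * u n j)) + δ)) :
    ∀ i, Filter.Tendsto (fun n => u n i) Filter.atTop (nhds (x i)) := by
  have hc0 : ∀ i j, 0 ≤ β * (if G.Adj i j then (1:ℝ) else 0) := by
    intro i j; split_ifs <;> linarith
  have hc1 : ∀ i j, β * (if G.Adj i j then (1:ℝ) else 0) ≤ 1 := by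
    intro i j; split_ifs <;> linarith
  generalize hc : (fun i j => β * (if G.Adj i j then (1:ℝ) else 0)) = c
  have hc' : ∀ i j, β * (if G.Adj i j then (1:ℝ) else 0) = c i j := by
    intro i j; rw [← hc]
  simp only [hc'] at *
  have hfac : ∀ (y : Fin N → ℝ), (∀ i, 0 ≤ y i) → (∀ i, y i ≤ 1) → ∀ i j,
      0 ≤ 1 - c i j * y j ∧ 1 - c i j * y j ≤ 1 := by
    intro y h0 h1 i j
    have a := mul_nonneg (hc0 i j) (h0 j)
    have b := mul_le_one₀ (hc1 i j) (h0 j) (h1 j)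
    constructor <;> linarith
  have hP0 : ∀ (y : Fin N → ℝ), (∀ i, 0 ≤ y i) → (∀ i, y i ≤ 1) → ∀ i,
      0 ≤ ∏ j, (1 - c i j * y j) := fun y h0 h1 i =>
    Finset.prod_nonneg fun j _ => (hfac y h0 h1 i j).1
  have hP1 : ∀ (y : Fin N → ℝ), (∀ i, 0 ≤ y i) → (∀ i, y i ≤ 1) → ∀ i,
      ∏ j, (1 - c i j * y j) ≤ 1 := fun y h0 h1 i =>
    Finset.prod_le_one (fun j _ => (hfac y h0 h1 i j).1) fun j _ => (hfac y h0 h1 i j).2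
  have hPm : ∀ (y z : Fin N → ℝ), (∀ i, 0 ≤ y i) → (∀ i, y i ≤ z i) → (∀ i, z i ≤ 1) → ∀ i,
      ∏ j, (1 - c i j * z j) ≤ ∏ j, (1 - c i j * y j) := by
    intro y z h0 hyz h1 i
    refine Finset.prod_le_prod
      (fun j _ => (hfac z (fun i => (h0 i).trans (hyz i)) h1 i j).1) fun j _ => ?_
    have := mul_le_mul_of_nonneg_left (hyz j) (hc0 i j)
    linarith
  have hmono : ∀ p q : ℝ, q ≤ p → p ≤ 1 → (1 - p) / ((1 - p) + δ) ≤ (1 - q) / ((1 - q) + δ) := by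
    intro p q hqp hp
    rw [div_le_div_iff₀ (by linarith) (by linarith)]
    nlinarith
  have htop : (1:ℝ) / (1 + δ) < 1 := by
    rw [div_lt_one (by linarith)]; linarith
  have hFx : ∀ i, x i = (1 - ∏ j, (1 - c i j * x j)) / ((1 - ∏ j, (1 - c i j * x j)) + δ) := by
    intro i
    have h := hstat i
    have := hP1 x (fun i => (hx0 i).le) (fun i => (hx1 i).le) i
    rw [eq_div_iff (by linarith)]
    linarith
  have hup : ∀ p : ℝ, 0 ≤ p → p ≤ 1 → (1 - p) / ((1 - p) + δ) ≤ 1 / (1 + δ) := by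
    intro p h0 h1
    simpa using hmono p 0 h0 h1
  have hbd : ∀ n, (∀ i, x i ≤ u n i) ∧ (∀ i, u n i ≤ 1 / (1 + δ)) := by
    intro n
    induction n with
    | zero =>
      refine ⟨fun i => ?_, fun i => (hu0 i).le⟩
      rw [hu0, hFx i]
      exact hup _ (hP0 x (fun i => (hx0 i).le) (fun i => (hx1 i).le) i)
        (hP1 x (fun i => (hx0 i).le) (fun i => (hx1 i).le) i)
    | succ n ih =>
      have a0 : ∀ i, 0 ≤ u n i := fun i => (hx0 i).le.trans (ih.1 i)
      have a1 : ∀ i, u n i ≤ 1 := fun i => (ih.2 i).trans htop.le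
      refine ⟨fun i => ?_, fun i => ?_⟩
      · rw [huS, hFx i]
        exact hmono _ _ (hPm x (u n) (fun i => (hx0 i).le) ih.1 a1 i)
          (hP1 x (fun i => (hx0 i).le) (fun i => (hx1 i).le) i)
      · rw [huS]
        exact hup _ (hP0 _ a0 a1 i) (hP1 _ a0 a1 i)
  have b0 : ∀ n i, 0 ≤ u n i := fun n i => (hx0 i).le.trans ((hbd n).1 i)
  have b1 : ∀ n i, u n i ≤ 1 := fun n i => ((hbd n).2 i).trans htop.le
  have hdec : ∀ n i, u (n + 1) i ≤ u n i := by
    intro n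
    induction n with
    | zero => intro i; rw [hu0 i]; exact (hbd _).2 i
    | succ n ih =>
      intro i
      rw [huS (n + 1) i, huS n i]
      exact hmono _ _ (hPm _ _ (b0 (n + 1)) ih (b1 n) i) (hP1 _ (b0 (n + 1)) (b1 (n + 1)) i)
  have hlim : ∀ i, ∃ l, Filter.Tendsto (fun n => u n i) Filter.atTop (nhds l) := by
    intro i
    refine ⟨_, tendsto_atTop_ciInf (antitone_nat_of_succ_le fun n => hdec n i) ⟨0, ?_⟩⟩
    rintro _ ⟨n, rfl⟩
    exact b0 n i
  choose y hy using hlim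
  have hyx : ∀ i, x i ≤ y i := fun i => ge_of_tendsto' (hy i) fun n => (hbd n).1 i
  have hyt : ∀ i, y i ≤ 1 / (1 + δ) := fun i => le_of_tendsto' (hy i) fun n => (hbd n).2 i
  have hy0 : ∀ i, 0 < y i := fun i => (hx0 i).trans_le (hyx i)
  have hy1 : ∀ i, y i < 1 := fun i => (hyt i).trans_lt htop
  have hyeq : y = x := by
    refine huniq y hy0 hy1 fun i => ?_
    have hp := hP1 y (fun i => (hy0 i).le) (fun i => (hy1 i).le) i
    have hPl : Filter.Tendsto (fun n => 1 - ∏ j, (1 - c i j * u n j)) Filter.atTop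
        (nhds (1 - ∏ j, (1 - c i j * y j))) :=
      tendsto_const_nhds.sub (tendsto_finsetProd _ fun j _ =>
        tendsto_const_nhds.sub ((hy j).const_mul _))
    have h1 := hPl.div (hPl.add_const δ) (by linarith)
    have h2 := (hy i).comp (Filter.tendsto_add_atTop_nat 1)
    have h3 := tendsto_nhds_unique (h2.congr fun n => huS n i) h1
    rw [eq_div_iff (by linarith)] at h3
    linarith
  intro i
  rw [← hyeq]
  exact hy i
end

section
/- Let G be a simple connected undirected graph on vertex set {1,…,N} with N ≥ 2 and adjacency matrix (a_{ij}), let β, δ ∈ (0,1] with β > δ, and let x be a positive stationary solution of the reactive SIS process on G. Define L_i^0 = 1 − δ/β for all i, and L_i^n = (1 − ∏_{j=1}^N (1 − β a_{ij} L_j^{n−1})) / ((1 − ∏_{j=1}^N (1 − β a_{ij} L_j^{n−1})) + δ). Then for every node i and every n ≥ 1: L_i^{n−1} ≤ L_i^n, and L_i^n ≤ x_i. -/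
/-- Let `G` be a simple connected undirected graph on `{1,…,N}` with `N ≥ 2`,
`β, δ ∈ (0,1]` with `β > δ`, and let `x` be a positive stationary solution of the reactive SIS
process on `G`.  Define `L 0 i = 1 - δ/β` and
`L (n+1) i = (1 - ∏ j, (1 - β a i j * L n j)) / ((1 - ∏ j, (1 - β a i j * L n j)) + δ)`.
Then for every node `i` and every `n ≥ 1` (written with `n+1`):
`L n i ≤ L (n+1) i` and `L (n+1) i ≤ x i`. -/
theorem reactive_lower_bounds_chain
    {N : ℕ} (hN : 2 ≤ N)
    (G : SimpleGraph (Fin N)) [DecidableRel G.Adj] (hconn : G.Connected)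
    (β δ : ℝ) (hβ0 : 0 < β) (hβ1 : β ≤ 1) (hδ0 : 0 < δ) (hδ1 : δ ≤ 1) (hβδ : δ < β)
    (x : Fin N → ℝ)
    (hx0 : ∀ i, 0 < x i) (hx1 : ∀ i, x i < 1)
    (hstat : ∀ i, δ * x i =
      (1 - x i) * (1 - ∏ j, (1 - β * (if G.Adj i j then (1:ℝ) else 0) * x j)))
    (L : ℕ → Fin N → ℝ)
    (hL0 : ∀ i, L 0 i = 1 - δ / β)
    (hLS : ∀ n i, L (n + 1) i =
      (1 - ∏ j, (1 - β * (if G.Adj i j then (1:ℝ) else 0) * L n j)) /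
        ((1 - ∏ j, (1 - β * (if G.Adj i j then (1:ℝ) else 0) * L n j)) + δ)) :
    ∀ i (n : ℕ), L n i ≤ L (n + 1) i ∧ L (n + 1) i ≤ x i := by
  set F : (Fin N → ℝ) → Fin N → ℝ := fun v i =>
    1 - ∏ j, (1 - β * (if G.Adj i j then (1:ℝ) else 0) * v j) with hF
  have fac : ∀ t : ℝ, 0 ≤ t → t ≤ 1 → ∀ i j : Fin N,
      0 ≤ 1 - β * (if G.Adj i j then (1:ℝ) else 0) * t ∧
      1 - β * (if G.Adj i j then (1:ℝ) else 0) * t ≤ 1 := by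
    intro t h0 h1 i j
    split_ifs
    · constructor <;> nlinarith
    · constructor <;> simp
  have Fmono : ∀ v w : Fin N → ℝ, (∀ j, v j ≤ w j) → (∀ j, 0 ≤ w j) → (∀ j, w j ≤ 1) →
      ∀ i, F v i ≤ F w i := by
    intro v w hvw h0 h1 i
    simp only [hF]
    have : ∏ j, (1 - β * (if G.Adj i j then (1:ℝ) else 0) * w j) ≤
        ∏ j, (1 - β * (if G.Adj i j then (1:ℝ) else 0) * v j) := by
      apply Finset.prod_le_prod
      · intro j _
        exact (fac _ (h0 j) (h1 j) i j).1
      · intro j _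
        have := hvw j
        split_ifs
        · nlinarith
        · simp
    linarith
  have Flow : ∀ v : Fin N → ℝ, (∀ j, 0 ≤ v j) → (∀ j, v j ≤ 1) →
      ∀ i k, G.Adj i k → β * v k ≤ F v i := by
    intro v h0 h1 i k hik
    simp only [hF]
    rw [← Finset.mul_prod_erase Finset.univ _ (Finset.mem_univ k)]
    have h2 : ∏ j ∈ Finset.univ.erase k,
        (1 - β * (if G.Adj i j then (1:ℝ) else 0) * v j) ≤ 1 :=
      Finset.prod_le_one (fun j _ => (fac _ (h0 j) (h1 j) i j).1)
        (fun j _ => (fac _ (h0 j) (h1 j) i j).2)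
    have h3 := (fac _ (h0 k) (h1 k) i k).1
    have h4 := mul_le_mul_of_nonneg_left h2 h3
    simp only [if_pos hik] at h4 ⊢
    linarith
  have Fnn : ∀ v : Fin N → ℝ, (∀ j, 0 ≤ v j) → (∀ j, v j ≤ 1) → ∀ i, 0 ≤ F v i := by
    intro v h0 h1 i
    have h2 : ∏ j, (1 - β * (if G.Adj i j then (1:ℝ) else 0) * v j) ≤ 1 :=
      Finset.prod_le_one (fun j _ => (fac _ (h0 j) (h1 j) i j).1)
        (fun j _ => (fac _ (h0 j) (h1 j) i j).2)
    simp only [hF]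
    linarith
  have hS : ∀ n i, L (n + 1) i = F (L n) i / (F (L n) i + δ) := hLS
  have hX : ∀ i, δ * x i = (1 - x i) * F x i := hstat
  have frac : ∀ a b : ℝ, 0 ≤ a → a ≤ b → a / (a + δ) ≤ b / (b + δ) := by
    intro a b ha hab
    rw [div_le_div_iff₀ (by linarith) (by linarith)]
    nlinarith
  have xfix : ∀ i, x i = F x i / (F x i + δ) := by
    intro i
    have := Fnn x (fun j => (hx0 j).le) (fun j => (hx1 j).le) i
    rw [eq_div_iff (by linarith)]
    linarith [hX i]
  have nbr : ∀ i, ∃ k, G.Adj i k := by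
    intro i
    haveI : Nontrivial (Fin N) := Fin.nontrivial_iff_two_le.mpr hN
    exact hconn.preconnected.exists_adj_of_nontrivial i
  have hc : 0 < 1 - δ / β := by
    have : δ / β < 1 := (div_lt_one hβ0).2 hβδ
    linarith
  have hc1 : 1 - δ / β < 1 := by
    have : 0 < δ / β := by positivity
    linarith
  have hcβ : β * (1 - δ / β) = β - δ := by field_simp
  have hL0' : ∀ i, L 0 i ≤ x i := by
    haveI : Nonempty (Fin N) := hconn.nonempty
    obtain ⟨m, hm⟩ := Finite.exists_min x
    intro i
    obtain ⟨k, hk⟩ := nbr m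
    have h1 := Flow x (fun j => (hx0 j).le) (fun j => (hx1 j).le) m k hk
    have h2 : β * x m ≤ F x m := (mul_le_mul_of_nonneg_left (hm k) hβ0.le).trans h1
    have h3 := mul_le_mul_of_nonneg_left h2 (sub_nonneg.2 (hx1 m).le)
    rw [← hX m] at h3
    have h4 : (1 - x m) * β ≤ δ := by
      apply le_of_mul_le_mul_right _ (hx0 m)
      linarith
    have h5 : 1 - x m ≤ δ / β := (le_div_iff₀ hβ0).2 h4
    rw [hL0 i]
    linarith [hm i]
  have hL01 : ∀ i, L 0 i ≤ L 1 i := by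
    intro i
    obtain ⟨k, hk⟩ := nbr i
    have h1 := Flow (L 0) (fun j => by rw [hL0]; exact hc.le)
      (fun j => by rw [hL0]; exact hc1.le) i k hk
    rw [hL0 k, hcβ] at h1
    have h2 := frac _ _ (by linarith) h1
    rw [← hS 0 i] at h2
    have h3 : (β - δ) / (β - δ + δ) = 1 - δ / β := by
      rw [sub_add_cancel]; field_simp
    rw [hL0 i, ← h3]
    exact h2
  have key : ∀ n, ∀ i, 0 ≤ L n i ∧ L n i ≤ L (n + 1) i ∧ L (n + 1) i ≤ x i := by
    have up : ∀ n, (∀ i, 0 ≤ L n i) → (∀ i, L n i ≤ x i) → ∀ i, L (n + 1) i ≤ x i := by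
      intro n h0 h1 i
      rw [hS n i, xfix i]
      exact frac _ _ (Fnn _ h0 (fun j => (h1 j).trans (hx1 j).le) i)
        (Fmono _ _ h1 (fun j => (hx0 j).le) (fun j => (hx1 j).le) i)
    intro n
    induction n with
    | zero =>
      have h0 : ∀ i, 0 ≤ L 0 i := fun j => by rw [hL0]; exact hc.le
      exact fun i => ⟨h0 i, hL01 i, up 0 h0 hL0' i⟩
    | succ n ih =>
      have h0 : ∀ i, 0 ≤ L (n + 1) i := fun i => (ih i).1.trans (ih i).2.1
      have h1 : ∀ i, L (n + 1) i ≤ 1 := fun i => (ih i).2.2.trans (hx1 i).le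
      intro i
      refine ⟨h0 i, ?_, up (n + 1) h0 (fun j => (ih j).2.2) i⟩
      rw [hS n i, hS (n + 1) i]
      exact frac _ _ (Fnn _ (fun j => (ih j).1) (fun j => (ih j).2.1.trans (h1 j)) i)
        (Fmono _ _ (fun j => (ih j).2.1) h0 h1 i)
  exact fun i n => (key n i).2
end

section
/- Let G = (V,E) be a simple connected undirected graph with |V| ≥ 2 and let G' = (V',E') be a connected subgraph of G with |V'| ≥ 2, V' ⊆ V, E' ⊆ E, and E' ≠ E. Let β, δ ∈ (0,1], let x be a positive stationary solution of the reactive SIS process on G, and let x' be a positive stationary solution of the reactive SIS process on G'. Then for every node i ∈ V', x'_i < x_i. -/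
theorem aux_bern {ι : Type*} (s : Finset ι) (a b : ι → ℝ) (c : ℝ) (hc : 1 ≤ c)
    (ha0 : ∀ j, 0 ≤ a j) (ha1 : ∀ j, a j < 1) (hb1 : ∀ j, b j < 1)
    (hab : ∀ j, a j ≤ c * b j) :
    1 - ∏ j ∈ s, (1 - a j) ≤ c * (1 - ∏ j ∈ s, (1 - b j)) := by
  classical
  have hc0 : 0 < c := by linarith
  have hy0 : ∀ j, 0 ≤ a j / c := fun j => div_nonneg (ha0 j) hc0.le
  have hya : ∀ j, a j / c ≤ a j := fun j => div_le_self (ha0 j) hc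
  have hyb : ∀ j, a j / c ≤ b j := fun j => by
    rw [div_le_iff₀ hc0]; linarith [hab j]
  have h1 : 1 - ∏ j ∈ s, (1 - a j) ≤ c * (1 - ∏ j ∈ s, (1 - a j / c)) := by
    induction s using Finset.induction_on with
    | empty => simp
    | insert k s hk ih =>
      rw [Finset.prod_insert hk, Finset.prod_insert hk]
      have hPQ : ∏ j ∈ s, (1 - a j) ≤ ∏ j ∈ s, (1 - a j / c) :=
        Finset.prod_le_prod (fun j _ => by linarith [ha1 j]) (fun j _ => by linarith [hya j])
      have hcy : a k = c * (a k / c) := by field_simp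
      have := mul_le_mul_of_nonneg_left hPQ (ha0 k)
      generalize ∏ j ∈ s, (1 - a j) = P at *
      generalize ∏ j ∈ s, (1 - a j / c) = Q at *
      have h2 : c * (1 - (1 - a k / c) * Q) = c * (1 - Q) + a k * Q := by
        field_simp; ring
      rw [h2]; linarith
  have h2 : ∏ j ∈ s, (1 - b j) ≤ ∏ j ∈ s, (1 - a j / c) :=
    Finset.prod_le_prod (fun j _ => by linarith [hb1 j]) (fun j _ => by linarith [hyb j])
  have := mul_le_mul_of_nonneg_left h2 hc0.le
  linarith

/-- Let `G` be a simple connected undirected graph on `{1,…,N}` with `N ≥ 2`,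
and let `G' = H` be a connected subgraph of `G` (vertex set `H.verts ⊆ V`, edge set
`H.edgeSet ⊆ G.edgeSet`) with at least two vertices and with `E' ≠ E`.  Let `β, δ ∈ (0,1]`,
let `x` be a positive stationary solution of the reactive SIS process on `G`, and let `x'` be
a positive stationary solution of the reactive SIS process on `G'`.  Then `x' i < x i` for
every node `i ∈ V'`. -/
theorem reactive_subgraph_lt
    {N : ℕ} (hN : 2 ≤ N)
    (G : SimpleGraph (Fin N)) [DecidableRel G.Adj] (hconn : G.Connected)
    (H : G.Subgraph) [DecidableRel H.Adj] (hHconn : H.Connected)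
    (hHcard : 2 ≤ H.verts.ncard) (hproper : H.edgeSet ≠ G.edgeSet)
    (β δ : ℝ) (hβ0 : 0 < β) (hβ1 : β ≤ 1) (hδ0 : 0 < δ) (hδ1 : δ ≤ 1)
    (x : Fin N → ℝ)
    (hx0 : ∀ i, 0 < x i) (hx1 : ∀ i, x i < 1)
    (hstat : ∀ i, δ * x i =
      (1 - x i) * (1 - ∏ j, (1 - β * (if G.Adj i j then (1:ℝ) else 0) * x j)))
    (x' : Fin N → ℝ)
    (hx'0 : ∀ i ∈ H.verts, 0 < x' i) (hx'1 : ∀ i ∈ H.verts, x' i < 1)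
    (hstat' : ∀ i ∈ H.verts, δ * x' i =
      (1 - x' i) * (1 - ∏ j, (1 - β * (if H.Adj i j then (1:ℝ) else 0) * x' j))) :
    ∀ i ∈ H.verts, x' i < x i := by
  have ha : ∀ i j, β * (if H.Adj i j then (1:ℝ) else 0) * x' j
      = if H.Adj i j then β * x' j else 0 := by intro i j; split_ifs <;> ring
  have hb : ∀ i j, β * (if G.Adj i j then (1:ℝ) else 0) * x j
      = if G.Adj i j then β * x j else 0 := by intro i j; split_ifs <;> ring
  simp only [ha] at hstat'
  simp only [hb] at hstat
  have ha0 : ∀ i j, 0 ≤ if H.Adj i j then β * x' j else 0 := by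
    intro i j; split_ifs with h
    · exact (mul_pos hβ0 (hx'0 j h.snd_mem)).le
    · exact le_rfl
  have ha1 : ∀ i j, (if H.Adj i j then β * x' j else 0) < 1 := by
    intro i j; split_ifs with h
    · have := hx'1 j h.snd_mem
      have := hx'0 j h.snd_mem
      nlinarith
    · exact one_pos
  have hb1 : ∀ i j, (if G.Adj i j then β * x j else 0) < 1 := by
    intro i j; split_ifs with h
    · have := hx1 j
      have := hx0 j
      nlinarith
    · exact one_pos
  have hab : ∀ c : ℝ, 1 ≤ c → (∀ j ∈ H.verts, x' j ≤ c * x j) → ∀ i j,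
      (if H.Adj i j then β * x' j else 0) ≤ c * (if G.Adj i j then β * x j else 0) := by
    intro c hc h i j
    by_cases hH : H.Adj i j
    · rw [if_pos hH, if_pos hH.adj_sub]
      have := mul_le_mul_of_nonneg_left (h j hH.snd_mem) hβ0.le
      linarith
    · rw [if_neg hH]
      apply mul_nonneg (by linarith)
      split_ifs
      · exact (mul_pos hβ0 (hx0 j)).le
      · exact le_rfl
  -- weak inequality
  have hle : ∀ j ∈ H.verts, x' j ≤ x j := by
    intro j₀ hj₀
    obtain ⟨i, hi, hmax⟩ := Set.exists_max_image H.verts (fun i => x' i / x i)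
      (Set.toFinite _) ⟨j₀, hj₀⟩
    by_contra hlt
    push Not at hlt
    have hc : 1 < x' i / x i :=
      lt_of_lt_of_le ((one_lt_div (hx0 j₀)).2 hlt) (hmax j₀ hj₀)
    have hci : x' i = x' i / x i * x i := by have := (hx0 i).ne'; field_simp
    have hcm : ∀ j ∈ H.verts, x' j ≤ x' i / x i * x j := fun j hj =>
      (div_le_iff₀ (hx0 j)).1 (hmax j hj)
    have key := aux_bern Finset.univ _ _ _ hc.le (ha0 i) (ha1 i) (hb1 i) (hab _ hc.le hcm i)
    have hxx : x i < x' i := (one_lt_div (hx0 i)).1 hc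
    have e1 := hstat i
    have e2 := hstat' i hi
    have p1 : 0 < 1 - x i := by linarith [hx1 i]
    have p2 : 0 < 1 - x' i := by linarith [hx'1 i hi]
    generalize x' i / x i = c at *
    generalize (1 - ∏ j, (1 - if G.Adj i j then β * x j else 0)) = B at *
    generalize (1 - ∏ j, (1 - if H.Adj i j then β * x' j else 0)) = A at *
    have k2 := mul_le_mul_of_nonneg_left key (mul_pos p1 p2).le
    have k3 : (1 - x i) * (1 - x' i) * A = δ * x' i * (1 - x i) := by rw [e2]; ring
    have k4 : (1 - x i) * (1 - x' i) * (c * B) = δ * x' i * (1 - x' i) := by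
      calc (1 - x i) * (1 - x' i) * (c * B) = (1 - x' i) * c * ((1 - x i) * B) := by ring
        _ = δ * (c * x i) * (1 - x' i) := by rw [← e1]; ring
        _ = _ := by rw [← hci]
    rw [k3, k4] at k2
    have := le_of_mul_le_mul_left k2 (mul_pos hδ0 (hx'0 i hi))
    linarith
  intro i₀ hi₀
  by_contra hnot
  push Not at hnot
  -- equality propagates along edges of G
  have hstep : ∀ i, (i ∈ H.verts ∧ x' i = x i) → ∀ j, G.Adj i j →
      H.Adj i j ∧ x' j = x j := by
    rintro i ⟨hi, hEq⟩ j hij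
    have hab1 : ∀ k, (if H.Adj i k then β * x' k else 0) ≤ if G.Adj i k then β * x k else 0 := by
      intro k
      have := hab 1 le_rfl (fun j hj => by linarith [hle j hj]) i k
      linarith
    have hj : (if H.Adj i j then β * x' j else 0) = if G.Adj i j then β * x j else 0 := by
      by_contra hne
      have hlt := lt_of_le_of_ne (hab1 j) hne
      have hprod : ∏ k, (1 - if G.Adj i k then β * x k else 0)
          < ∏ k, (1 - if H.Adj i k then β * x' k else 0) :=
        Finset.prod_lt_prod (fun k _ => by linarith [hb1 i k])
          (fun k _ => by linarith [hab1 k]) ⟨j, Finset.mem_univ j, by linarith⟩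
      have e1 := hstat i
      have e2 := hstat' i hi
      rw [hEq] at e2
      have p1 : 0 < 1 - x i := by linarith [hx1 i]
      have := mul_lt_mul_of_pos_left hprod p1
      linarith
    have hpos := mul_pos hβ0 (hx0 j)
    rw [if_pos hij] at hj
    by_cases hH : H.Adj i j
    · rw [if_pos hH] at hj
      exact ⟨hH, mul_left_cancel₀ hβ0.ne' hj⟩
    · rw [if_neg hH] at hj
      linarith
  have hall : ∀ i, i ∈ H.verts ∧ x' i = x i := by
    intro i
    obtain ⟨w⟩ := hconn.preconnected i₀ i
    have : ∀ u v, G.Walk u v → (u ∈ H.verts ∧ x' u = x u) → (v ∈ H.verts ∧ x' v = x v) := by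
      intro u v w
      induction w with
      | nil => exact id
      | cons h p ih =>
        intro hu
        obtain ⟨h1, h2⟩ := hstep _ hu _ h
        exact ih ⟨h1.snd_mem, h2⟩
    exact this _ _ w ⟨hi₀, le_antisymm (hle i₀ hi₀) hnot⟩
  apply hproper
  ext e
  induction e using Sym2.ind with
  | _ u v =>
    rw [SimpleGraph.Subgraph.mem_edgeSet, SimpleGraph.mem_edgeSet]
    exact ⟨fun h => h.adj_sub, fun h => (hstep u (hall u) v h).1⟩
end

section
/- Let G be a simple connected undirected graph on vertex set {1,…,N} with N ≥ 2, adjacency matrix (a_{ij}) and degrees k_i = ∑_j a_{ij}, and let β, δ ∈ (0,1]. If x is a positive stationary solution of the contact-process SIS model on G, then for every node i: (1 − e^{−β x_i}) / ((1 − e^{−β x_i}) + δ) < x_i ≤ 1 − δ/β. -/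
lemma one_sub_sum_le_prod_aux {ι : Type*} (s : Finset ι) (f : ι → ℝ)
    (h0 : ∀ j ∈ s, 0 ≤ f j) (h1 : ∀ j ∈ s, f j ≤ 1) :
    1 - ∑ j ∈ s, f j ≤ ∏ j ∈ s, (1 - f j) := by
  classical
  induction s using Finset.induction_on with
  | empty => simp
  | insert a s ha ih =>
    rw [Finset.sum_insert ha, Finset.prod_insert ha]
    have ih' := ih (fun j hj => h0 j (Finset.mem_insert_of_mem hj))
      (fun j hj => h1 j (Finset.mem_insert_of_mem hj))
    have a0 := h0 a (Finset.mem_insert_self a s)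
    have a1 := h1 a (Finset.mem_insert_self a s)
    have hs : 0 ≤ ∑ j ∈ s, f j :=
      Finset.sum_nonneg (fun j hj => h0 j (Finset.mem_insert_of_mem hj))
    nlinarith [mul_le_mul_of_nonneg_left ih' (sub_nonneg.mpr a1), mul_nonneg a0 hs]

/-- Let `G` be a simple connected undirected graph on `{1,…,N}` with `N ≥ 2`,
degrees `kᵢ = G.degree i`, and `β, δ ∈ (0,1]`.  If `x` is a positive stationary solution of
the contact-process SIS model on `G`, i.e. `0 < x i < 1` and
`δ * x i = (1 - x i) * (1 - ∏ j, (1 - β * (a i j / kᵢ) * x j))` for all `i`, then for every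
node `i`:  `(1 - e^{-β x i}) / ((1 - e^{-β x i}) + δ) < x i ≤ 1 - δ/β`. -/
theorem contact_bounds_zero
    {N : ℕ} (hN : 2 ≤ N)
    (G : SimpleGraph (Fin N)) [DecidableRel G.Adj] (hconn : G.Connected)
    (β δ : ℝ) (hβ0 : 0 < β) (hβ1 : β ≤ 1) (hδ0 : 0 < δ) (hδ1 : δ ≤ 1)
    (x : Fin N → ℝ)
    (hx0 : ∀ i, 0 < x i) (hx1 : ∀ i, x i < 1)
    (hstat : ∀ i, δ * x i =
      (1 - x i) * (1 - ∏ j,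
        (1 - β * ((if G.Adj i j then (1:ℝ) else 0) / (G.degree i : ℝ)) * x j))) :
    ∀ i, (1 - Real.exp (-(β * x i))) / ((1 - Real.exp (-(β * x i))) + δ) < x i ∧
      x i ≤ 1 - δ / β := by
  have : NeZero N := ⟨by omega⟩
  have : Nontrivial (Fin N) := Fin.nontrivial_iff_two_le.mpr hN
  have hdeg : ∀ i, 0 < G.degree i := fun i => hconn.preconnected.degree_pos_of_nontrivial i
  set r : Fin N → Fin N → ℝ := fun i j => (if G.Adj i j then (1:ℝ) else 0) / (G.degree i : ℝ)
    with hr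
  have hstat' : ∀ i, δ * x i = (1 - x i) * (1 - ∏ j, (1 - β * r i j * x j)) := hstat
  have hr0 : ∀ i j, 0 ≤ r i j := by
    intro i j
    simp only [hr]
    split_ifs <;> positivity
  have hr1 : ∀ i j, r i j ≤ 1 := by
    intro i j
    have h1 : (1:ℝ) ≤ G.degree i := by exact_mod_cast hdeg i
    simp only [hr]
    rw [div_le_one (by linarith)]
    split_ifs <;> linarith
  have hrs : ∀ i, ∑ j, r i j = 1 := by
    intro i
    have h1 : (G.degree i : ℝ) ≠ 0 := by exact_mod_cast (hdeg i).ne'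
    simp only [hr]
    rw [← Finset.sum_div, Finset.sum_boole, div_eq_one_iff_eq h1]
    rw [← SimpleGraph.card_neighborFinset_eq_degree, SimpleGraph.neighborFinset_eq_filter]
  have ha0 : ∀ i j, 0 ≤ β * r i j * x j := fun i j =>
    mul_nonneg (mul_nonneg hβ0.le (hr0 i j)) (hx0 j).le
  have ha1 : ∀ i j, β * r i j * x j < 1 := by
    intro i j
    have h1 : β * r i j ≤ 1 := mul_le_one₀ hβ1 (hr0 i j) (hr1 i j)
    have h2 : β * r i j * x j ≤ 1 * x j := mul_le_mul_of_nonneg_right h1 (hx0 j).le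
    linarith [hx1 j]
  obtain ⟨m, -, hm⟩ := Finset.exists_min_image Finset.univ x Finset.univ_nonempty
  obtain ⟨M, -, hM⟩ := Finset.exists_max_image Finset.univ x Finset.univ_nonempty
  have hupM : δ ≤ β * (1 - x M) := by
    have h1 : 1 - ∑ j, β * r M j * x j ≤ ∏ j, (1 - β * r M j * x j) :=
      one_sub_sum_le_prod_aux _ _ (fun j _ => ha0 M j) (fun j _ => (ha1 M j).le)
    have h2 : ∑ j, β * r M j * x j ≤ ∑ j, r M j * (β * x M) := by
      apply Finset.sum_le_sum
      intro j _
      have := mul_le_mul_of_nonneg_left (hM j (Finset.mem_univ j))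
        (mul_nonneg hβ0.le (hr0 M j))
      linarith
    rw [← Finset.sum_mul, hrs, one_mul] at h2
    have h3 : δ * x M ≤ (1 - x M) * (β * x M) := by
      rw [hstat' M]
      exact mul_le_mul_of_nonneg_left (by linarith) (by linarith [hx1 M])
    exact le_of_mul_le_mul_right (by linarith) (hx0 M)
  have hlowm : (1 - x m) * (1 - Real.exp (-(β * x m))) < δ * x m := by
    have h1 : ∏ j, (1 - β * r m j * x j) < ∏ j, Real.exp (-(β * r m j * x j)) := by
      apply Finset.prod_lt_prod
      · intro j _
        linarith [ha1 m j]
      · intro j _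
        linarith [Real.add_one_le_exp (-(β * r m j * x j))]
      · obtain ⟨j, hj⟩ := (G.degree_pos_iff_exists_adj m).mp (hdeg m)
        refine ⟨j, Finset.mem_univ j, ?_⟩
        have hp : 0 < r m j := by
          have h1 : (0:ℝ) < G.degree m := by exact_mod_cast hdeg m
          simp only [hr, if_pos hj]
          positivity
        have hp2 : 0 < β * r m j * x j := mul_pos (mul_pos hβ0 hp) (hx0 j)
        linarith [Real.add_one_lt_exp (x := -(β * r m j * x j)) (by linarith)]
    rw [← Real.exp_sum, Finset.sum_neg_distrib] at h1
    have h2 : ∑ j, r m j * (β * x m) ≤ ∑ j, β * r m j * x j := by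
      apply Finset.sum_le_sum
      intro j _
      have := mul_le_mul_of_nonneg_left (hm j (Finset.mem_univ j))
        (mul_nonneg hβ0.le (hr0 m j))
      linarith
    rw [← Finset.sum_mul, hrs, one_mul] at h2
    have h3 : Real.exp (-∑ j, β * r m j * x j) ≤ Real.exp (-(β * x m)) :=
      Real.exp_le_exp.mpr (by linarith)
    rw [hstat' m]
    exact mul_lt_mul_of_pos_left (by linarith) (by linarith [hx1 m])
  intro i
  have hmi := hm i (Finset.mem_univ i)
  have hMi := hM i (Finset.mem_univ i)
  have hy := hx0 i
  have hmp := hx0 m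
  constructor
  · have he : Real.exp (-(β * x i)) < 1 := by
        rw [← Real.exp_zero]
        exact Real.exp_lt_exp.mpr (by nlinarith)
    rw [div_lt_iff₀ (by linarith)]
    -- convexity of the exponential
    have hc : x i * Real.exp (-(β * x m)) ≤ x i - x m + x m * Real.exp (-(β * x i)) := by
      have h := convexOn_exp.2 (Set.mem_univ (0:ℝ)) (Set.mem_univ (-(β * x i)))
        (show 0 ≤ 1 - x m / x i by rw [sub_nonneg, div_le_one hy]; exact hmi)
        (show 0 ≤ x m / x i by positivity) (by ring)
      simp only [smul_eq_mul, mul_zero, zero_add, Real.exp_zero, mul_one] at h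
      have e1 : x m / x i * -(β * x i) = -(β * x m) := by field_simp
      rw [e1] at h
      have h' := mul_le_mul_of_nonneg_left h hy.le
      have e2 : x i * (1 - x m / x i + x m / x i * Real.exp (-(β * x i)))
          = x i - x m + x m * Real.exp (-(β * x i)) := by field_simp
      linarith
    have key : x m * ((1 - x i) * (1 - Real.exp (-(β * x i)))) < x m * (δ * x i) := by
      have s1 : (1 - x i) * (x m * (1 - Real.exp (-(β * x i))))
          ≤ (1 - x i) * (x i * (1 - Real.exp (-(β * x m)))) :=
        mul_le_mul_of_nonneg_left (by linarith) (by linarith [hx1 i])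
      have em : Real.exp (-(β * x m)) < 1 := by
        rw [← Real.exp_zero]
        exact Real.exp_lt_exp.mpr (by nlinarith)
      have s2 : (1 - x i) * (x i * (1 - Real.exp (-(β * x m))))
          ≤ (1 - x m) * (x i * (1 - Real.exp (-(β * x m)))) :=
        mul_le_mul_of_nonneg_right (by linarith) (mul_nonneg hy.le (by linarith))
      have s3 := mul_lt_mul_of_pos_left hlowm hy
      linarith
    have := lt_of_mul_lt_mul_left key hmp.le
    linarith
  · have h1 : δ / β ≤ 1 - x M := by
      rw [div_le_iff₀ hβ0]; linarith
    linarith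
end

section
/- Let G be the star graph with hub node h and k ≥ 1 leaf nodes, and let β, δ ∈ (0,1]. If x is a positive stationary solution of the reactive SIS process on G, then every leaf node l satisfies x_l = β x_h / (β x_h + δ), and the hub value satisfies x_h = (1 − (1 − β² x_h/(β x_h + δ))^k) / ((1 − (1 − β² x_h/(β x_h + δ))^k) + δ). -/
/-- Let `G` be the star graph with hub node `h` and `k ≥ 1` leaf nodes
(so `G` has `k+1` vertices and `u` is adjacent to `v` iff exactly one of them is the hub),
and let `β, δ ∈ (0,1]`.  If `x` is a positive stationary solution of the reactive SIS
process on `G`, then every leaf `l` satisfies `x l = β x h / (β x h + δ)`, and the hub value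
satisfies
`x h = (1 - (1 - β² x h/(β x h + δ))^k) / ((1 - (1 - β² x h/(β x h + δ))^k) + δ)`. -/
theorem star_reactive_stationary
    (k : ℕ) (hk : 1 ≤ k)
    (G : SimpleGraph (Fin (k + 1))) [DecidableRel G.Adj] (h : Fin (k + 1))
    (hstar : ∀ u v, G.Adj u v ↔ (u = h ∧ v ≠ h) ∨ (v = h ∧ u ≠ h))
    (β δ : ℝ) (hβ0 : 0 < β) (hβ1 : β ≤ 1) (hδ0 : 0 < δ) (hδ1 : δ ≤ 1)
    (x : Fin (k + 1) → ℝ)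
    (hx0 : ∀ i, 0 < x i) (hx1 : ∀ i, x i < 1)
    (hstat : ∀ i, δ * x i =
      (1 - x i) * (1 - ∏ j, (1 - β * (if G.Adj i j then (1:ℝ) else 0) * x j))) :
    (∀ l, l ≠ h → x l = β * x h / (β * x h + δ)) ∧
      x h = (1 - (1 - β ^ 2 * x h / (β * x h + δ)) ^ k) /
        ((1 - (1 - β ^ 2 * x h / (β * x h + δ)) ^ k) + δ) := by
  have hh := hx0 h
  have hpos : 0 < β * x h + δ := by positivity
  have leaf : ∀ l, l ≠ h → x l = β * x h / (β * x h + δ) := by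
    intro l hl
    have hp : ∏ j, (1 - β * (if G.Adj l j then (1:ℝ) else 0) * x j) = 1 - β * x h := by
      rw [Finset.prod_eq_single h]
      · have : G.Adj l h := (hstar l h).2 (Or.inr ⟨rfl, hl⟩)
        simp [this]
      · intro b _ hb
        have : ¬ G.Adj l b := by
          rw [hstar]
          tauto
        simp [this]
      · simp
    have e := hstat l
    rw [hp] at e
    rw [eq_div_iff hpos.ne']
    linarith
  refine ⟨leaf, ?_⟩
  have hp : ∏ j, (1 - β * (if G.Adj h j then (1:ℝ) else 0) * x j)
      = (1 - β ^ 2 * x h / (β * x h + δ)) ^ k := by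
    rw [← Finset.mul_prod_erase Finset.univ _ (Finset.mem_univ h)]
    rw [Finset.prod_congr rfl (g := fun _ => 1 - β ^ 2 * x h / (β * x h + δ))]
    · simp
    · intro j hj
      have hj' : j ≠ h := Finset.ne_of_mem_erase hj
      have : G.Adj h j := (hstar h j).2 (Or.inl ⟨rfl, hj'⟩)
      rw [if_pos this, leaf j hj']
      ring
  have e := hstat h
  rw [hp] at e
  generalize (1 - β ^ 2 * x h / (β * x h + δ)) ^ k = p at e ⊢
  have h1 : 0 < 1 - x h := by linarith [hx1 h]
  have h2 : 0 < (1 - x h) * (1 - p) := by rw [← e]; positivity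
  have hq : 0 < 1 - p := pos_of_mul_pos_right h2 h1.le
  rw [eq_div_iff (by positivity)]
  linarith
end

section
/- Let G = (V,E) be a simple connected undirected graph with |V| ≥ 3, let i ∈ V be a node of degree k_i whose 1-hop neighborhood G_i^1 (the star consisting of i, its neighbors, and the edges from i to its neighbors) is a proper subgraph of G (E_i^1 ≠ E). Let β, δ ∈ (0,1], let x be a positive stationary solution of the reactive SIS process on G, and let x' be a positive stationary solution of the reactive SIS process on the star G_i^1 (so x' is the hub value satisfying x'_i = (1 − (1 − β² x'_i/(β x'_i + δ))^{k_i}) / ((1 − (1 − β² x'_i/(β x'_i + δ))^{k_i}) + δ)). Then x'_i < x_i. -/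
theorem exists_nbr_with_other {N : ℕ} (G : SimpleGraph (Fin N)) (hconn : G.Connected)
    (i : Fin N) (hproper : ∃ u v, G.Adj u v ∧ u ≠ i ∧ v ≠ i) :
    ∃ v w, G.Adj i v ∧ G.Adj v w ∧ w ≠ i := by
  by_contra hcon
  push Not at hcon
  obtain ⟨u, v, huv, hu, hv⟩ := hproper
  have key : ∀ z, z = i ∨ G.Adj i z := by
    intro z
    have h := (SimpleGraph.reachable_iff_reflTransGen i z).1 (hconn.preconnected i z)
    induction h with
    | refl => exact Or.inl rfl
    | tail _ hbc ih =>
      rcases ih with h | h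
      · subst h; exact Or.inr hbc
      · exact Or.inl (hcon _ _ h hbc)
  rcases key u with h | h
  · exact hu h
  · exact hv (hcon _ _ h huv)

theorem star_mono (β δ y z : ℝ) (hβ0 : 0 < β) (hβ1 : β ≤ 1) (hδ0 : 0 < δ) (hy : 0 < y)
    (hyz : y ≤ z) (k : ℕ) :
    (1 - (1 - β ^ 2 * z / (β * z + δ)) ^ k) * y ≤ (1 - (1 - β ^ 2 * y / (β * y + δ)) ^ k) * z := by
  have hz : 0 < z := lt_of_lt_of_le hy hyz
  have hdy : 0 < β * y + δ := by positivity
  have hdz : 0 < β * z + δ := by positivity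
  have q1 : ∀ t : ℝ, 0 < t → 0 ≤ 1 - β ^ 2 * t / (β * t + δ) := by
    intro t ht
    have : 0 < β * t + δ := by positivity
    rw [sub_nonneg, div_le_one this]
    nlinarith [mul_pos hβ0 ht]
  have qm : 1 - β ^ 2 * z / (β * z + δ) ≤ 1 - β ^ 2 * y / (β * y + δ) := by
    apply sub_le_sub_left
    rw [div_le_div_iff₀ hdy hdz]
    have : 0 ≤ β ^ 2 * δ * (z - y) := by
      have := sub_nonneg.2 hyz
      positivity
    nlinarith
  have geo : ∀ t : ℝ, 1 - (1 - β ^ 2 * t / (β * t + δ)) ^ k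
      = (∑ j ∈ Finset.range k, (1 - β ^ 2 * t / (β * t + δ)) ^ j) * (β ^ 2 / (β * t + δ)) * t := by
    intro t
    have := geom_sum_mul (1 - β ^ 2 * t / (β * t + δ)) k
    rw [mul_assoc, div_mul_eq_mul_div]
    linarith
  rw [geo z, geo y]
  have h1 : (∑ j ∈ Finset.range k, (1 - β ^ 2 * z / (β * z + δ)) ^ j) ≤
      (∑ j ∈ Finset.range k, (1 - β ^ 2 * y / (β * y + δ)) ^ j) :=
    Finset.sum_le_sum fun j _ => pow_le_pow_left₀ (q1 z hz) qm j
  have h2 : β ^ 2 / (β * z + δ) ≤ β ^ 2 / (β * y + δ) := by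
    gcongr
  have h0 : 0 ≤ (∑ j ∈ Finset.range k, (1 - β ^ 2 * y / (β * y + δ)) ^ j) :=
    Finset.sum_nonneg fun j _ => pow_nonneg (q1 y hy) j
  have h3 := mul_le_mul h1 h2 (by positivity) h0
  have := mul_le_mul_of_nonneg_right h3 (mul_pos hy hz).le
  nlinarith

/-- Let `G` be a simple connected undirected graph on `{1,…,N}` with
`N ≥ 3`, let `i` be a node of degree `kᵢ` whose 1-hop neighborhood (the star of `i` and its
incident edges) is a proper subgraph of `G`, i.e. `G` has an edge not incident to `i`.  Let
`β, δ ∈ (0,1]`, let `x` be a positive stationary solution of the reactive SIS process on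
`G`, and let `x'` be the hub value of a positive stationary solution of the reactive SIS
process on the star `G_i^1`, i.e. `0 < x' < 1` and
`x' = (1 - (1 - β² x'/(β x' + δ))^kᵢ) / ((1 - (1 - β² x'/(β x' + δ))^kᵢ) + δ)`.
Then `x' < x i`. -/
theorem star_lower_bound_lt
    {N : ℕ} (hN : 3 ≤ N)
    (G : SimpleGraph (Fin N)) [DecidableRel G.Adj] (hconn : G.Connected)
    (i : Fin N) (hproper : ∃ u v, G.Adj u v ∧ u ≠ i ∧ v ≠ i)
    (β δ : ℝ) (hβ0 : 0 < β) (hβ1 : β ≤ 1) (hδ0 : 0 < δ) (hδ1 : δ ≤ 1)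
    (x : Fin N → ℝ)
    (hx0 : ∀ u, 0 < x u) (hx1 : ∀ u, x u < 1)
    (hstat : ∀ u, δ * x u =
      (1 - x u) * (1 - ∏ v, (1 - β * (if G.Adj u v then (1:ℝ) else 0) * x v)))
    (x' : ℝ) (hx'0 : 0 < x') (hx'1 : x' < 1)
    (hx'eq : x' = (1 - (1 - β ^ 2 * x' / (β * x' + δ)) ^ (G.degree i)) /
      ((1 - (1 - β ^ 2 * x' / (β * x' + δ)) ^ (G.degree i)) + δ)) :
    x' < x i := by
  classical
  have hf : ∀ u v, 0 < 1 - β * (if G.Adj u v then (1:ℝ) else 0) * x v ∧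
      1 - β * (if G.Adj u v then (1:ℝ) else 0) * x v ≤ 1 := by
    intro u v
    have h0 := hx0 v
    have h1 := hx1 v
    have := mul_pos hβ0 h0
    split_ifs
    · constructor <;> nlinarith
    · simp
  have hy0 := hx0 i
  have hy1 := hx1 i
  have hby : 0 < β * x i := mul_pos hβ0 hy0
  have hd : 0 < β * x i + δ := by positivity
  have hprod : ∀ v, G.Adj i v → ∏ w, (1 - β * (if G.Adj v w then (1:ℝ) else 0) * x w)
      ≤ 1 - β * x i := by
    intro v hv
    rw [← Finset.mul_prod_erase _ _ (Finset.mem_univ i)]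
    have h1 : ∏ w ∈ Finset.univ.erase i, (1 - β * (if G.Adj v w then (1:ℝ) else 0) * x w) ≤ 1 :=
      Finset.prod_le_one (fun w _ => (hf v w).1.le) (fun w _ => (hf v w).2)
    have h2 := mul_le_mul_of_nonneg_left h1 (hf v i).1.le
    simpa [hv.symm] using h2
  have hprod' : ∀ v w, G.Adj i v → G.Adj v w → w ≠ i →
      ∏ w, (1 - β * (if G.Adj v w then (1:ℝ) else 0) * x w) < 1 - β * x i := by
    intro v w hv hw hwi
    rw [← Finset.mul_prod_erase _ _ (Finset.mem_univ i),
      ← Finset.mul_prod_erase _ _ (Finset.mem_erase.2 ⟨hwi, Finset.mem_univ w⟩)]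
    have h1 : ∏ w ∈ (Finset.univ.erase i).erase w,
        (1 - β * (if G.Adj v w then (1:ℝ) else 0) * x w) ≤ 1 :=
      Finset.prod_le_one (fun w _ => (hf v w).1.le) (fun w _ => (hf v w).2)
    have h2 := mul_le_mul_of_nonneg_left h1 (hf v w).1.le
    have h3 : 1 - β * (if G.Adj v w then (1:ℝ) else 0) * x w < 1 := by
      have := mul_pos hβ0 (hx0 w)
      simp only [hw, if_true]; linarith
    have h4 := mul_lt_mul_of_pos_left (lt_of_le_of_lt (h2.trans_eq (mul_one _)) h3) (hf v i).1
    have h5 : 1 - β * (if G.Adj v i then (1:ℝ) else 0) * x i = 1 - β * x i := by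
      simp [hv.symm]
    rw [h5, mul_one] at h4
    rw [h5]
    exact h4
  have hlow : ∀ v, G.Adj i v → β * x i / (β * x i + δ) ≤ x v := by
    intro v hv
    rw [div_le_iff₀ hd]
    have h1 := hprod v hv
    have h2 := hstat v
    have h3 := mul_le_mul_of_nonneg_left h1 (sub_pos.2 (hx1 v)).le
    linarith
  have hlow' : ∀ v w, G.Adj i v → G.Adj v w → w ≠ i → β * x i / (β * x i + δ) < x v := by
    intro v w hv hw hwi
    rw [div_lt_iff₀ hd]
    have h1 := hprod' v w hv hw hwi
    have h2 := hstat v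
    have h3 := mul_lt_mul_of_pos_left h1 (sub_pos.2 (hx1 v))
    linarith
  have heq : β ^ 2 * x i / (β * x i + δ) = β * (β * x i / (β * x i + δ)) := by ring
  obtain ⟨v, w, hv, hw, hwi⟩ := exists_nbr_with_other G hconn i hproper
  have hlt : ∏ v, (1 - β * (if G.Adj i v then (1:ℝ) else 0) * x v) <
      (1 - β ^ 2 * x i / (β * x i + δ)) ^ (G.degree i) := by
    have hc : (1 - β ^ 2 * x i / (β * x i + δ)) ^ (G.degree i) =
        ∏ v, (if G.Adj i v then (1 - β ^ 2 * x i / (β * x i + δ)) else 1) := by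
      rw [Finset.prod_ite, Finset.prod_const, Finset.prod_const_one, mul_one,
        ← G.card_neighborFinset_eq_degree, G.neighborFinset_eq_filter]
    rw [hc]
    apply Finset.prod_lt_prod
    · intro u _; exact (hf i u).1
    · intro u _
      split_ifs with h
      · have := mul_le_mul_of_nonneg_left (hlow u h) hβ0.le
        rw [heq]; linarith
      · simp
    · refine ⟨v, Finset.mem_univ v, ?_⟩
      have := mul_lt_mul_of_pos_left (hlow' v w hv hw hwi) hβ0
      simp only [hv, if_true]
      rw [heq]; linarith
  by_contra hle
  push Not at hle
  have hm := star_mono β δ (x i) x' hβ0 hβ1 hδ0 hy0 hle (G.degree i)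
  have hs := hstat i
  have h1 := mul_lt_mul_of_pos_left hlt (sub_pos.2 hy1)
  set P := (1 - β ^ 2 * x i / (β * x i + δ)) ^ (G.degree i)
  set Q := (1 - β ^ 2 * x' / (β * x' + δ)) ^ (G.degree i)
  have hne : (1 - Q) + δ ≠ 0 := by
    intro h
    rw [h, div_zero] at hx'eq
    exact hx'0.ne' hx'eq
  rw [eq_div_iff hne] at hx'eq
  have hQ : δ * x' = (1 - x') * (1 - Q) := by linarith
  have h2 : (1 - x i) * (1 - P) < δ * x i := by linarith
  have hQ0 : 0 < 1 - Q := by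
    by_contra h
    push Not at h
    have := mul_pos hδ0 hx'0
    nlinarith
  have h3 := mul_lt_mul_of_pos_right h2 hx'0
  have h4 := mul_le_mul_of_nonneg_left hm (sub_pos.2 hy1).le
  have h5 : δ * x' * x i = (1 - x') * (1 - Q) * x i := by rw [hQ]
  have h6 : 0 ≤ (x' - x i) * ((1 - Q) * x i) :=
    mul_nonneg (sub_nonneg.2 hle) (mul_pos hQ0 hy0).le
  nlinarith
end
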